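/- Let K be a field, n = 2m, and S = K[x₁,…,xₙ]. Let X be the m×(m+1) generic Hankel matrix with entries x₁,…,xₙ, let P₁ be the m×m Hankel matrix obtained from X by dropping the last column (entries x₁,…,x_{n−1}), let P₂ be the m×m Hankel matrix obtained from X by dropping the first column (entries x₂,…,xₙ), and let f = det(P₁)·det(P₂). Then, with respect to a diagonal term order, lt(f) is a squarefree monomial, and the determinantal ideal I_t(X) belongs to C_f for every t = 1,…,m. -/

import Mathlib

open MvPolynomial

/-- The leading exponent (degree) of a multivariate polynomial with respect to a
monomial order: the maximum of its support. -/
noncomputable def MonomialOrder.degreeOf {σ : Type*} {K : Type*} [CommSemiring K]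
    (m : MonomialOrder σ) (f : MvPolynomial σ K) : σ →₀ ℕ :=
  m.toSyn.symm (f.support.sup m.toSyn)

/-- The leading term `lt(f)` of a polynomial with respect to a monomial order. -/
noncomputable def MonomialOrder.leadTerm {σ : Type*} {K : Type*} [CommSemiring K]
    (m : MonomialOrder σ) (f : MvPolynomial σ K) : MvPolynomial σ K :=
  monomial (m.degreeOf f) (f.coeff (m.degreeOf f))

/-- The initial ideal `lt(I)` of an ideal, generated by leading terms of its
nonzero elements. -/
noncomputable def MonomialOrder.initialIdeal {σ : Type*} {K : Type*} [CommSemiring K]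
    (m : MonomialOrder σ) (I : Ideal (MvPolynomial σ K)) : Ideal (MvPolynomial σ K) :=
  Ideal.span { g | ∃ f ∈ I, f ≠ 0 ∧ g = m.leadTerm f }

/-- The leading term of `f` is a squarefree monomial. -/
def MonomialOrder.HasSqfreeLeadTerm {σ : Type*} {K : Type*} [CommSemiring K]
    (m : MonomialOrder σ) (f : MvPolynomial σ K) : Prop :=
  f ≠ 0 ∧ ∀ i, m.degreeOf f i ≤ 1

/-- The family `C_f` of Knutson ideals associated to `f` : the smallest family of ideals
containing `(f)`, closed under colon by arbitrary ideals, sums and intersections. -/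
inductive KnutsonFamily {σ : Type*} {K : Type*} [CommRing K] (f : MvPolynomial σ K) :
    Ideal (MvPolynomial σ K) → Prop
  | base : KnutsonFamily f (Ideal.span {f})
  | colon (I J : Ideal (MvPolynomial σ K)) : KnutsonFamily f I → KnutsonFamily f (I.colon J)
  | add (I J : Ideal (MvPolynomial σ K)) :
      KnutsonFamily f I → KnutsonFamily f J → KnutsonFamily f (I + J)
  | inter (I J : Ideal (MvPolynomial σ K)) :
      KnutsonFamily f I → KnutsonFamily f J → KnutsonFamily f (I ⊓ J)

/-- A squarefree monomial ideal : an ideal generated by squarefree monomials. -/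
def IsSqfreeMonomialIdeal {σ : Type*} {K : Type*} [CommSemiring K]
    (J : Ideal (MvPolynomial σ K)) : Prop :=
  ∃ G : Set (MvPolynomial σ K),
    (∀ g ∈ G, ∃ s : Finset σ, g = ∏ i ∈ s, X i) ∧ J = Ideal.span G

/-- `I_t(M)` : the ideal generated by the `t × t` minors of a matrix `M`. -/
noncomputable def minorsIdeal {R : Type*} [CommRing R] {r s : ℕ} (t : ℕ)
    (M : Matrix (Fin r) (Fin s) R) : Ideal R :=
  Ideal.span {d | ∃ (ρ : Fin t → Fin r) (γ : Fin t → Fin s),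
    StrictMono ρ ∧ StrictMono γ ∧ d = (M.submatrix ρ γ).det}

section RectHankel

variable (K : Type*) [Field K] (m : ℕ)

/-- `X` : the generic `m × (m+1)` Hankel matrix with entries `x₁, …, x_{2m}`
(zero-indexed: entry `(i,j)` is `X (i+j)`). -/
noncomputable def hankelX' : Matrix (Fin m) (Fin (m + 1)) (MvPolynomial (Fin (2 * m)) K) :=
  fun i j => MvPolynomial.X ⟨i.1 + j.1, by have := i.isLt; have := j.isLt; omega⟩

/-- `P₁` : the `m × m` Hankel matrix obtained from `X` by dropping the last column
(entries `x₁, …, x_{2m-1}`). -/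
noncomputable def hankelP1' : Matrix (Fin m) (Fin m) (MvPolynomial (Fin (2 * m)) K) :=
  fun i j => MvPolynomial.X ⟨i.1 + j.1, by have := i.isLt; have := j.isLt; omega⟩

/-- `P₂` : the `m × m` Hankel matrix obtained from `X` by dropping the first column
(entries `x₂, …, x_{2m}`). -/
noncomputable def hankelP2' : Matrix (Fin m) (Fin m) (MvPolynomial (Fin (2 * m)) K) :=
  fun i j => MvPolynomial.X ⟨i.1 + j.1 + 1, by have := i.isLt; have := j.isLt; omega⟩

end RectHankel

namespace HK

/-- `T` contains a 2-separated chain of length `t` inside `[a,b)`. -/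
def Ch (t a b : ℕ) (T : Set ℕ) : Prop :=
  ∃ c : ℕ → ℕ, (∀ k, k + 1 < t → c k + 2 ≤ c (k + 1)) ∧ ∀ k, k < t → a ≤ c k ∧ c k < b ∧ c k ∈ T

lemma Ch.mono {t a b a' b' : ℕ} {T T' : Set ℕ} (h : Ch t a b T) (ha : a' ≤ a) (hb : b ≤ b')
    (hT : T ⊆ T') : Ch t a' b' T' := by
  obtain ⟨c, h1, h2⟩ := h
  refine ⟨c, h1, fun k hk => ?_⟩
  obtain ⟨h3, h4, h5⟩ := h2 k hk
  exact ⟨by omega, by omega, hT h5⟩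

/-- splicing two chains: the first `k+1` elements of `c`, then `e` starting at index `j`. -/
lemma splice {t a b : ℕ} {T : Set ℕ} (c e : ℕ → ℕ) (k j s : ℕ) (ht : t + j = k + 1 + s)
    (_hjs : j ≤ s)
    (hc : ∀ i, i < k → c i + 2 ≤ c (i + 1)) (he : ∀ i, j ≤ i → i + 1 < s → e i + 2 ≤ e (i + 1))
    (hce : j < s → c k + 2 ≤ e j)
    (hc' : ∀ i, i ≤ k → a ≤ c i ∧ c i < b ∧ c i ∈ T)
    (he' : ∀ i, j ≤ i → i < s → a ≤ e i ∧ e i < b ∧ e i ∈ T) : Ch t a b T := by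
  refine ⟨fun i => if i ≤ k then c i else e (i - (k + 1) + j), ?_, ?_⟩
  · intro i hi
    by_cases h1 : i + 1 ≤ k
    · have : i ≤ k := by omega
      simp only [h1, this, if_true]; exact hc i (by omega)
    · by_cases h2 : i ≤ k
      · simp only [h1, h2, if_true, if_false]
        have : i = k := by omega
        subst this
        have : i + 1 - (i + 1) + j = j := by omega
        rw [this]; exact hce (by omega)
      · simp only [h1, h2, if_false]
        have : i + 1 - (k + 1) + j = i - (k + 1) + j + 1 := by omega
        rw [this]; exact he _ (by omega) (by omega)
  · intro i hi
    by_cases h1 : i ≤ k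
    · simp only [h1, if_true]; exact hc' i h1
    · simp only [h1, if_false]; exact he' _ (by omega) (by omega)

lemma comb2 {n s : ℕ} (hs : 1 ≤ s) (hn : n ≠ 2 * s) {T : Set ℕ} (hB : Ch s 1 n T)
    (hC : Ch s 0 (n - 1) T) : Ch (s + 1) 0 n T ∨ Ch s 1 (n - 1) T := by
  obtain ⟨e, he, he'⟩ := hB
  obtain ⟨c, hc, hc'⟩ := hC
  by_contra hcon
  push Not at hcon
  obtain ⟨h1, h2⟩ := hcon
  -- exchange 1
  have e1 : ∀ k, k < s → e k ≤ c k + 1 := by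
    intro k hk
    by_contra h
    apply h1
    refine splice c e k k s (by omega) (by omega) (fun i hi => hc i (by omega))
      (fun i _ hi => he i hi) (fun _ => by omega) (fun i hi => ?_) (fun i _ hi => ?_)
    · obtain ⟨_, q, r⟩ := hc' i (by omega)
      exact ⟨by omega, by omega, r⟩
    · obtain ⟨_, q, r⟩ := he' i (by omega)
      exact ⟨by omega, by omega, r⟩
  have emono : ∀ i j, i ≤ j → j < s → e i + 2 * (j - i) ≤ e j := by
    intro i j hij
    induction j, hij using Nat.le_induction with
    | base => intro _; simp
    | succ j hj ih => intro h; have := ih (by omega); have := he j h; omega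
  have cmono : ∀ i j, i ≤ j → j < s → c i + 2 * (j - i) ≤ c j := by
    intro i j hij
    induction j, hij using Nat.le_induction with
    | base => intro _; simp
    | succ j hj ih => intro h; have := ih (by omega); have := hc j h; omega
  have elast : e (s - 1) = n - 1 := by
    by_contra h
    apply h2
    refine ⟨e, he, fun k hk => ?_⟩
    have := emono k (s - 1) (by omega) (by omega)
    obtain ⟨p, q, r⟩ := he' k hk
    have := he' (s - 1) (by omega)
    exact ⟨p, by omega, r⟩
  have cfirst : c 0 = 0 := by
    by_contra h
    apply h2
    refine ⟨c, hc, fun k hk => ?_⟩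
    have := cmono 0 k (by omega) (by omega)
    obtain ⟨p, q, r⟩ := hc' k hk
    exact ⟨by omega, q, r⟩
  have e2 : ∀ k, k + 1 < s → c (k + 1) ≤ e k + 1 := by
    intro k hk
    by_contra h
    apply h2
    refine splice e c k (k + 1) s (by omega) (by omega) (fun i hi => he i (by omega))
      (fun i _ hi => hc i hi) (fun _ => by omega) (fun i hi => ?_) (fun i _ hi => ?_)
    · obtain ⟨p, q, r⟩ := he' i (by omega)
      have := emono i (s - 1) (by omega) (by omega)
      exact ⟨by omega, by omega, r⟩
    · obtain ⟨p, q, r⟩ := hc' i (by omega)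
      have := cmono 0 i (by omega) (by omega)
      exact ⟨by omega, by omega, r⟩
  have hk : ∀ k, k < s → c k ≤ 2 * k := by
    intro k
    induction k with
    | zero => intro _; omega
    | succ k ih => intro h; have := ih (by omega); have := e1 k (by omega); have := e2 k h; omega
  have a1 := hk (s - 1) (by omega)
  have a2 := e1 (s - 1) (by omega)
  have a3 := cmono 0 (s - 1) (by omega) (by omega)
  have a4 := hc' (s - 1) (by omega)
  omega

lemma comb1 {n s : ℕ} (hn : 2 * (s + 1) ≤ n) {T : Set ℕ} (hA : Ch (s + 1) 0 n T)
    (hD : Ch s 1 (n - 1) T) : Ch (s + 1) 1 n T ∨ Ch (s + 1) 0 (n - 1) T := by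
  obtain ⟨c, hc, hc'⟩ := hA
  obtain ⟨e, he, he'⟩ := hD
  by_contra hcon
  push Not at hcon
  obtain ⟨h1, h2⟩ := hcon
  have cmono : ∀ i j, i ≤ j → j < s + 1 → c i + 2 * (j - i) ≤ c j := by
    intro i j hij
    induction j, hij using Nat.le_induction with
    | base => intro _; simp
    | succ j hj ih => intro h; have := ih (by omega); have := hc j h; omega
  have cfirst : c 0 = 0 := by
    by_contra h
    apply h1
    refine ⟨c, hc, fun k hk => ?_⟩
    have := cmono 0 k (by omega) (by omega)
    obtain ⟨p, q, r⟩ := hc' k hk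
    exact ⟨by omega, q, r⟩
  have clast : c s = n - 1 := by
    by_contra h
    apply h2
    refine ⟨c, hc, fun k hk => ?_⟩
    have := cmono k s (by omega) (by omega)
    obtain ⟨p, q, r⟩ := hc' k hk
    have := hc' s (by omega)
    exact ⟨p, by omega, r⟩
  have e1 : ∀ k, k < s → e k ≤ c k + 1 := by
    intro k hk
    by_contra h
    apply h2
    refine splice c e k k s (by omega) (by omega) (fun i hi => hc i (by omega))
      (fun i _ hi => he i hi) (fun _ => by omega) (fun i hi => ?_) (fun i _ hi => ?_)
    · obtain ⟨_, q, r⟩ := hc' i (by omega)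
      have := cmono i s (by omega) (by omega)
      exact ⟨by omega, by omega, r⟩
    · obtain ⟨_, q, r⟩ := he' i (by omega)
      exact ⟨by omega, by omega, r⟩
  have e2 : ∀ k, k < s → c (k + 1) ≤ e k + 1 := by
    intro k hk
    by_contra h
    apply h1
    refine splice e c k (k + 1) (s + 1) (by omega) (by omega) (fun i hi => he i (by omega))
      (fun i _ hi => hc i hi) (fun _ => by omega) (fun i hi => ?_) (fun i _ hi => ?_)
    · obtain ⟨p, q, r⟩ := he' i (by omega)
      exact ⟨by omega, by omega, r⟩
    · obtain ⟨p, q, r⟩ := hc' i (by omega)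
      have := cmono 0 i (by omega) (by omega)
      exact ⟨by omega, by omega, r⟩
  have hk : ∀ k, k < s + 1 → c k ≤ 2 * k := by
    intro k
    induction k with
    | zero => intro _; omega
    | succ k ih =>
      intro h
      have := ih (by omega)
      have := e1 k (by omega)
      have := e2 k (by omega)
      omega
  have := hk s (by omega)
  omega

/-- a set without chains of length `r+1` is covered by `r` disjoint consecutive pairs -/
lemma cover (b : ℕ) (T : Set ℕ) : ∀ (r a : ℕ), ¬ Ch (r + 1) a b T →
    ∃ p : ℕ → ℕ, (∀ k, p k + 2 ≤ p (k + 1)) ∧ a ≤ p 0 ∧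
      ∀ i, a ≤ i → i < b → i ∈ T → ∃ k, k < r ∧ (i = p k ∨ i = p k + 1) := by
  classical
  intro r
  induction r with
  | zero =>
    intro a h
    refine ⟨fun k => a + 2 * k, fun k => by simp only; omega, by simp, fun i h1 h2 h3 => ?_⟩
    exact absurd ⟨fun _ => i, by omega, fun k _ => ⟨h1, h2, h3⟩⟩ h
  | succ r ih =>
    intro a h
    by_cases hex : ∃ i, a ≤ i ∧ i < b ∧ i ∈ T
    · obtain ⟨h1, h2, h3⟩ := Nat.find_spec hex
      have hmin := fun i => @Nat.find_min' _ _ hex i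
      generalize Nat.find hex = q at *
      obtain ⟨p, hp1, hp2, hp3⟩ := ih (q + 2) (by
        rintro ⟨c, hc, hc'⟩
        apply h
        refine splice (fun _ => q) c 0 0 (r + 1) (by omega) (by omega) (by omega)
          (fun i _ hi => hc i hi) (fun _ => (hc' 0 (by omega)).1) (fun i _ => ⟨h1, h2, h3⟩)
          (fun i _ hi => ?_)
        obtain ⟨x, y, z⟩ := hc' i hi
        exact ⟨by omega, y, z⟩)
      refine ⟨fun k => if k = 0 then q else p (k - 1), ?_, by simpa using h1, ?_⟩
      · intro k
        rcases k with _ | k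
        · simpa using hp2
        · simpa using hp1 k
      · intro i hi1 hi2 hi3
        have := hmin i ⟨hi1, hi2, hi3⟩
        by_cases hq : q + 2 ≤ i
        · obtain ⟨k, hk, hk'⟩ := hp3 i hq hi2 hi3
          exact ⟨k + 1, by omega, by simpa using hk'⟩
        · refine ⟨0, by omega, ?_⟩
          simp only [if_true]; omega
    · refine ⟨fun k => a + 2 * k, fun k => by simp only; omega, by simp, fun i h1 h2 h3 => ?_⟩
      exact absurd ⟨i, h1, h2, h3⟩ hex

open MvPolynomial

section Grob

variable {n : ℕ} {K : Type*} [Field K]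

/-- the weight `∑ u_i i²` -/
noncomputable def wt : (Fin n →₀ ℕ) →+ ℕ := Finsupp.weight (fun i : Fin n => (i : ℕ) ^ 2)

/-- polynomials all of whose monomials have weight `< N` -/
def W (K : Type*) [Field K] (n N : ℕ) : Submodule K (MvPolynomial (Fin n) K) where
  carrier := {g | ∀ u, coeff u g ≠ 0 → wt u < N}
  add_mem' := by
    intro a b ha hb u hu
    by_cases h : coeff u a = 0
    · exact hb u (fun h' => hu (by rw [coeff_add, h, h', add_zero]))
    · exact ha u h
  zero_mem' := by intro u hu; simp at hu
  smul_mem' := by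
    intro c a ha u hu
    exact ha u (fun h => hu (by rw [coeff_smul, h, smul_zero]))

lemma mem_W {N : ℕ} {g : MvPolynomial (Fin n) K} :
    g ∈ W K n N ↔ ∀ u, coeff u g ≠ 0 → wt u < N := Iff.rfl

lemma W_mono {N N' : ℕ} (h : N ≤ N') {g : MvPolynomial (Fin n) K} (hg : g ∈ W K n N) :
    g ∈ W K n N' := fun u hu => lt_of_lt_of_le (hg u hu) h

lemma exists_W (g : MvPolynomial (Fin n) K) : ∃ N, g ∈ W K n N := by
  refine ⟨g.support.sup (fun u => wt u) + 1, fun u hu => ?_⟩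
  have := Finset.le_sup (f := fun u => wt u) (mem_support_iff.mpr hu)
  exact Nat.lt_succ_of_le this

lemma W_zero {g : MvPolynomial (Fin n) K} (hg : g ∈ W K n 0) : g = 0 := by
  ext u
  by_contra h
  exact absurd (hg u (by simpa using h)) (by omega)

/-- `I` has elements with leading monomial every `u ∈ M` -/
def Lower (I : Ideal (MvPolynomial (Fin n) K)) (M : (Fin n →₀ ℕ) → Prop) : Prop :=
  ∀ u, M u → ∃ h ∈ I, h - monomial u 1 ∈ W K n (wt u)

/-- all monomials in weight-initial forms of elements of `I` are in `M` -/
def Upper (I : Ideal (MvPolynomial (Fin n) K)) (M : (Fin n →₀ ℕ) → Prop) : Prop :=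
  ∀ g ∈ I, ∀ N, g ∈ W K n (N + 1) → ∀ u, coeff u g ≠ 0 → wt u = N → M u

lemma Lower.mono {I J : Ideal (MvPolynomial (Fin n) K)} {M M' : (Fin n →₀ ℕ) → Prop}
    (h : Lower I M) (hIJ : I ≤ J) (hM : ∀ u, M' u → M u) : Lower J M' := by
  intro u hu
  obtain ⟨g, hg, hg'⟩ := h u (hM u hu)
  exact ⟨g, hIJ hg, hg'⟩

lemma Upper.inf {I J : Ideal (MvPolynomial (Fin n) K)} {M M' : (Fin n →₀ ℕ) → Prop}
    (h : Upper I M) (h' : Upper J M') : Upper (I ⊓ J) (fun u => M u ∧ M' u) :=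
  fun g hg N hN u hu huN => ⟨h g hg.1 N hN u hu huN, h' g hg.2 N hN u hu huN⟩

lemma reduce {I : Ideal (MvPolynomial (Fin n) K)} {M : (Fin n →₀ ℕ) → Prop} (hI : Lower I M)
    {N : ℕ} {g : MvPolynomial (Fin n) K} (hg : g ∈ W K n (N + 1))
    (hM : ∀ u, coeff u g ≠ 0 → wt u = N → M u) : ∃ h ∈ I, g - h ∈ W K n N := by
  classical
  have : ∀ u, ∃ h ∈ I, M u → h - monomial u 1 ∈ W K n (wt u) := by
    intro u
    by_cases hu : M u
    · obtain ⟨h, h1, h2⟩ := hI u hu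
      exact ⟨h, h1, fun _ => h2⟩
    · exact ⟨0, I.zero_mem, fun h => absurd h hu⟩
  choose h hI hh using this
  refine ⟨∑ u ∈ g.support with wt u = N, C (coeff u g) * h u,
    I.sum_mem fun u _ => I.mul_mem_left _ (hI u), ?_⟩
  have key : g - ∑ u ∈ g.support with wt u = N, C (coeff u g) * h u =
      (∑ u ∈ g.support with ¬ wt u = N, monomial u (coeff u g)) -
        ∑ u ∈ g.support with wt u = N, coeff u g • (h u - monomial u 1) := by
    have hs := Finset.sum_filter_add_sum_filter_not g.support (fun u => wt u = N)
      (fun u => monomial u (coeff u g))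
    rw [← as_sum] at hs
    have h2 : ∀ u, coeff u g • (h u - monomial u (1 : K)) =
        C (coeff u g) * h u - monomial u (coeff u g) := by
      intro u
      rw [smul_sub, smul_monomial, smul_eq_mul, mul_one, smul_eq_C_mul]
    simp only [h2, Finset.sum_sub_distrib]
    linear_combination (-1 : MvPolynomial (Fin n) K) * hs
  rw [key]
  refine Submodule.sub_mem _ (Submodule.sum_mem _ fun u hu => ?_)
    (Submodule.sum_mem _ fun u hu => Submodule.smul_mem _ _ ?_)
  · simp only [Finset.mem_filter, mem_support_iff] at hu
    intro v hv
    rw [coeff_monomial] at hv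
    split_ifs at hv with h1
    · subst h1
      have := hg u hu.1
      have := hu.2
      omega
    · exact absurd rfl hv
  · simp only [Finset.mem_filter, mem_support_iff] at hu
    have := hh u (hM u hu.1 hu.2)
    rwa [hu.2] at this

lemma eq_of_le {I J : Ideal (MvPolynomial (Fin n) K)} {M : (Fin n →₀ ℕ) → Prop} (hIJ : I ≤ J)
    (hI : Lower I M) (hJ : Upper J M) : I = J := by
  refine le_antisymm hIJ ?_
  have : ∀ N, ∀ g ∈ J, g ∈ W K n N → g ∈ I := by
    intro N
    induction N with
    | zero => intro g _ hg; rw [W_zero hg]; exact I.zero_mem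
    | succ N ih =>
      intro g hgJ hg
      obtain ⟨h, h1, h2⟩ := reduce hI hg (fun u hu hN => hJ g hgJ N hg u hu hN)
      have := ih (g - h) (J.sub_mem hgJ (hIJ h1)) h2
      simpa using I.add_mem this h1
  intro g hg
  obtain ⟨N, hN⟩ := exists_W g
  exact this N g hg hN

lemma not_le {L A : Ideal (MvPolynomial (Fin n) K)} {M M' : (Fin n →₀ ℕ) → Prop}
    (hL : Lower L M) (hA : Upper A M') (u : Fin n →₀ ℕ) (hu : M u) (hu' : ¬ M' u) : ¬ L ≤ A := by
  classical
  intro hle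
  obtain ⟨h, h1, h2⟩ := hL u hu
  apply hu'
  refine hA h (hle h1) (wt u) ?_ u ?_ rfl
  · have : h = (h - monomial u 1) + monomial u 1 := by ring
    rw [this]
    refine Submodule.add_mem _ (W_mono (by omega) h2) ?_
    intro v hv
    rw [coeff_monomial] at hv
    split_ifs at hv with h1
    · subst h1; omega
    · exact absurd rfl hv
  · intro h0
    have := h2 u (by rw [coeff_sub, h0]; simp)
    omega

end Grob

section Hank

variable {n : ℕ} {K : Type*} [Field K]

/-- the variable `x_i`, or `0` when out of range -/
noncomputable def xv (n : ℕ) (K : Type*) [Field K] (i : ℕ) : MvPolynomial (Fin n) K :=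
  if h : i < n then X ⟨i, h⟩ else 0

/-- a minor of an infinite Hankel matrix -/
noncomputable def mn (n : ℕ) (K : Type*) [Field K] {t : ℕ} (ρ γ : Fin t → ℕ) :
    MvPolynomial (Fin n) K :=
  Matrix.det (Matrix.of fun k l => xv n K (ρ k + γ l))

/-- ideal of all Hankel `t`-minors involving only variables with index in `[a,b)` -/
noncomputable def HI (n : ℕ) (K : Type*) [Field K] (t a b : ℕ) : Ideal (MvPolynomial (Fin n) K) :=
  Ideal.span {d | ∃ ρ γ : Fin t → ℕ, StrictMono ρ ∧ StrictMono γ ∧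
    (∀ k l, a ≤ ρ k + γ l ∧ ρ k + γ l < b) ∧ d = mn n K ρ γ}

/-- initial monomials of the `t`-minors -/
def MM (t a b : ℕ) (u : Fin n →₀ ℕ) : Prop := Ch t a b {i | ∃ h : i < n, u ⟨i, h⟩ ≠ 0}

lemma HI_mono {t a b a' b' : ℕ} (ha : a' ≤ a) (hb : b ≤ b') : HI n K t a b ≤ HI n K t a' b' := by
  refine Ideal.span_mono ?_
  rintro d ⟨ρ, γ, h1, h2, h3, h4⟩
  exact ⟨ρ, γ, h1, h2, fun k l => ⟨by have := (h3 k l).1; omega, by have := (h3 k l).2; omega⟩, h4⟩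

lemma HI_succ_left {t a b : ℕ} : HI n K (t + 1) a b ≤ HI n K t (a + 1) b := by
  refine Ideal.span_le.mpr ?_
  rintro d ⟨ρ, γ, h1, h2, h3, rfl⟩
  rw [mn, Matrix.det_succ_column_zero]
  refine Ideal.sum_mem _ fun i _ => Ideal.mul_mem_left _ _ (Ideal.subset_span ?_)
  refine ⟨ρ ∘ i.succAbove, γ ∘ Fin.succ, h1.comp (Fin.strictMono_succAbove i),
    h2.comp (Fin.strictMono_succ), fun k l => ⟨?_, (h3 _ _).2⟩, rfl⟩
  have := (h3 (i.succAbove k) 0).1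
  have := h2 (Fin.succ_pos l)
  simp only [Function.comp]; omega

lemma HI_succ_right {t a b : ℕ} : HI n K (t + 1) a b ≤ HI n K t a (b - 1) := by
  refine Ideal.span_le.mpr ?_
  rintro d ⟨ρ, γ, h1, h2, h3, rfl⟩
  rw [mn, Matrix.det_succ_column _ (Fin.last t)]
  refine Ideal.sum_mem _ fun i _ => Ideal.mul_mem_left _ _ (Ideal.subset_span ?_)
  refine ⟨ρ ∘ i.succAbove, γ ∘ (Fin.last t).succAbove, h1.comp (Fin.strictMono_succAbove i),
    h2.comp (Fin.strictMono_succAbove _), fun k l => ⟨(h3 _ _).1, ?_⟩, rfl⟩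
  have := (h3 (i.succAbove k) (Fin.last t)).2
  have : γ ((Fin.last t).succAbove l) < γ (Fin.last t) := h2 (by simp [Fin.castSucc_lt_last])
  simp only [Function.comp]; omega

lemma wt_sum_single {t : ℕ} (c : Fin t → Fin n) :
    wt (∑ k, Finsupp.single (c k) 1) = ∑ k, ((c k : ℕ)) ^ 2 := by
  simp [wt, map_sum, Finsupp.weight_single]

lemma prod_xv {t : ℕ} (c : Fin t → ℕ) (hc : ∀ k, c k < n) :
    ∏ k, xv n K (c k) = monomial (∑ k, Finsupp.single (⟨c k, hc k⟩ : Fin n) 1) 1 := by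
  rw [monomial_sum_one]
  refine Finset.prod_congr rfl fun k _ => ?_
  rw [xv, dif_pos (hc k)]
  rfl

lemma perm_eq_one_of_mono {t : ℕ} (σ : Equiv.Perm (Fin t)) (h : Monotone σ) : σ = 1 := by
  have h2 : StrictMono σ := h.strictMono_of_injective σ.injective
  have := Subsingleton.elim (h2.orderIsoOfSurjective σ σ.surjective) (OrderIso.refl _)
  ext i
  have h3 := congrArg (fun f : Fin t ≃o Fin t => ((f i : Fin t) : ℕ)) this
  simpa using h3

lemma minor_lead {t : ℕ} (ρ γ : Fin t → ℕ) (hρ : StrictMono ρ) (hγ : StrictMono γ)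
    (hn : ∀ k l, ρ k + γ l < n) :
    mn n K ρ γ - monomial (∑ k, Finsupp.single (⟨ρ k + γ k, hn k k⟩ : Fin n) 1) 1 ∈
      W K n (wt (∑ k, Finsupp.single (⟨ρ k + γ k, hn k k⟩ : Fin n) 1)) := by
  classical
  rw [mn, Matrix.det_apply, ← Finset.add_sum_erase _ _ (Finset.mem_univ (1 : Equiv.Perm (Fin t)))]
  simp only [Equiv.Perm.sign_one, one_smul, Matrix.of_apply, Equiv.Perm.one_apply]
  rw [prod_xv (fun k => ρ k + γ k) (fun k => hn k k), add_sub_cancel_left]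
  refine Submodule.sum_mem _ fun σ hσ => ?_
  have hσ1 : σ ≠ 1 := (Finset.mem_erase.mp hσ).1
  rw [prod_xv (fun k => ρ (σ k) + γ k) (fun k => hn _ k), wt_sum_single]
  intro v hv
  rw [Units.smul_def, coeff_smul, coeff_monomial] at hv
  split_ifs at hv with h1
  · rw [← h1, wt_sum_single]
    simp only
    have hlt : ∑ k, ρ (σ k) * γ k < ∑ k, ρ k * γ k := by
      rw [Monovary.sum_comp_perm_mul_lt_sum_mul_iff]
      · intro hm
        apply hσ1
        apply perm_eq_one_of_mono
        intro i j hij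
        rcases hij.eq_or_lt with h | h
        · rw [h]
        · exact hρ.le_iff_le.mp (hm (hγ h))
      · intro i j hij
        exact hρ.monotone (hγ.lt_iff_lt.mp hij).le
    have e1 : ∑ k, ρ (σ k) ^ 2 = ∑ k, ρ k ^ 2 := Equiv.sum_comp σ (fun k => ρ k ^ 2)
    have e2 : ∀ σ : Equiv.Perm (Fin t), ∑ k, (ρ (σ k) + γ k) ^ 2 =
        ∑ k, ρ (σ k) ^ 2 + 2 * ∑ k, ρ (σ k) * γ k + ∑ k, γ k ^ 2 := by
      intro σ
      rw [Finset.mul_sum, ← Finset.sum_add_distrib, ← Finset.sum_add_distrib]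
      exact Finset.sum_congr rfl fun k _ => by ring
    have e3 := e2 1
    simp only [Equiv.Perm.one_apply] at e3
    rw [e2, e3, e1]
    omega
  · simp at hv

lemma chain_lt {t : ℕ} {c : ℕ → ℕ} (hc : ∀ k, k + 1 < t → c k + 2 ≤ c (k + 1)) :
    ∀ i j, i ≤ j → j < t → c i + 2 * (j - i) ≤ c j := by
  intro i j hij
  induction j, hij using Nat.le_induction with
  | base => intro _; simp
  | succ j hj ih => intro h; have := ih (by omega); have := hc j h; omega

lemma lower_of {t a b : ℕ} (hb : b ≤ n) (I : Ideal (MvPolynomial (Fin n) K))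
    (hI : ∀ c : ℕ → ℕ, (∀ k, k + 1 < t → c k + 2 ≤ c (k + 1)) → (∀ k, k < t → a ≤ c k ∧ c k < b) →
      mn n K (fun k : Fin t => c k / 2) (fun k : Fin t => (c k + 1) / 2) ∈ I) :
    Lower I (MM t a b) := by
  classical
  rintro u ⟨c, hc, hc'⟩
  have hm := hI c hc (fun k hk => ⟨(hc' k hk).1, (hc' k hk).2.1⟩)
  have hlt := chain_lt hc
  have hn : ∀ k l : Fin t, c k / 2 + (c l + 1) / 2 < n := by
    intro k l
    have hk := k.2
    have hl := l.2
    have h1 := hlt k (t - 1) (by omega) (by omega)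
    have h2 := hlt l (t - 1) (by omega) (by omega)
    have h3 := hc' (t - 1) (by omega)
    omega
  have hlead := minor_lead (n := n) (K := K) (fun k : Fin t => c k / 2)
    (fun k : Fin t => (c k + 1) / 2)
    (fun i j hij => by have := hlt i j hij.le j.2; have : (i : ℕ) < j := hij; simp only; omega)
    (fun i j hij => by have := hlt i j hij.le j.2; have : (i : ℕ) < j := hij; simp only; omega) hn
  set w : Fin n →₀ ℕ := ∑ k : Fin t, Finsupp.single (⟨c k / 2 + (c k + 1) / 2, hn k k⟩ : Fin n) 1
    with hw
  have hwu : w ≤ u := by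
    intro i
    rw [hw, Finsupp.finsetSum_apply]
    simp only [Finsupp.single_apply]
    by_cases hex : ∃ k : Fin t, (⟨c k / 2 + (c k + 1) / 2, hn k k⟩ : Fin n) = i
    · obtain ⟨k, hk⟩ := hex
      rw [Finset.sum_eq_single k]
      · rw [if_pos hk]
        obtain ⟨_, _, h1, h2⟩ := hc' k k.2
        have : i = ⟨c k, h1⟩ := by rw [← hk]; ext; simp only; omega
        rw [this]; omega
      · intro l _ hl
        rw [if_neg]
        intro h
        rw [← hk, Fin.mk.injEq] at h
        have hne : (l : ℕ) ≠ k := fun h => hl (Fin.ext h)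
        rcases lt_or_gt_of_ne hne with h' | h'
        · have := hlt l k h'.le k.2; omega
        · have := hlt k l h'.le l.2; omega
      · simp
    · rw [Finset.sum_eq_zero]
      · omega
      · intro k _
        rw [if_neg (fun h => hex ⟨k, h⟩)]
  obtain ⟨v, rfl⟩ := exists_add_of_le hwu
  refine ⟨monomial v 1 * mn n K (fun k : Fin t => c k / 2) (fun k : Fin t => (c k + 1) / 2),
    I.mul_mem_left _ hm, ?_⟩
  have : (monomial (w + v) (1 : K)) = monomial v 1 * monomial w 1 := by
    rw [monomial_mul, add_comm, one_mul]
  rw [this, ← mul_sub]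
  intro x hx
  rw [coeff_monomial_mul'] at hx
  split_ifs at hx with h1
  · rw [one_mul] at hx
    have := hlead _ hx
    obtain ⟨y, rfl⟩ := exists_add_of_le h1
    rw [add_tsub_cancel_left] at this
    rw [map_add, map_add]; omega
  · exact absurd rfl hx

lemma lower_HI {t a b : ℕ} (hb : b ≤ n) : Lower (HI n K t a b) (MM t a b) := by
  refine lower_of hb _ fun c hc hc' => Ideal.subset_span ?_
  have hlt := chain_lt hc
  refine ⟨fun k : Fin t => c k / 2, fun k : Fin t => (c k + 1) / 2,
    (fun i j hij => by have := hlt i j hij.le j.2; have : (i : ℕ) < j := hij; simp only; omega),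
    (fun i j hij => by have := hlt i j hij.le j.2; have : (i : ℕ) < j := hij; simp only; omega),
    fun k l => ?_, rfl⟩
  have hk := k.2
  have hl := l.2
  have h1 := hlt k (t - 1) (by omega) (by omega)
  have h2 := hlt l (t - 1) (by omega) (by omega)
  have h3 := hc' (t - 1) (by omega)
  have h1 := hlt 0 k (by omega) (by omega)
  have h2 := hlt 0 l (by omega) (by omega)
  have h3 := hc' 0 (by omega)
  simp only
  omega

end Hank

section Param

variable {n : ℕ} {K : Type*} [Field K]

/-- the parametrization of `r`-secants of the rational normal curve (variables outside `[a,b)`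
are free) -/
noncomputable def phi (n : ℕ) (K : Type*) [Field K] (r a b : ℕ) :
    MvPolynomial (Fin n) K →ₐ[K] MvPolynomial (ℕ ⊕ ℕ ⊕ ℕ) K :=
  aeval (fun i : Fin n => if a ≤ (i : ℕ) ∧ (i : ℕ) < b then
    ∑ k ∈ Finset.range r, X (Sum.inl k) * X (Sum.inr (Sum.inl k)) ^ (i : ℕ)
    else X (Sum.inr (Sum.inr (i : ℕ))))

lemma det_low_rank {R : Type*} [CommRing R] (r : ℕ) (A B : ℕ → R) (ρ γ : Fin (r + 1) → ℕ) :
    Matrix.det (Matrix.of fun k l : Fin (r + 1) =>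
      ∑ j ∈ Finset.range r, A j * B j ^ (ρ k + γ l)) = 0 := by
  have : (Matrix.of fun k l : Fin (r + 1) => ∑ j ∈ Finset.range r, A j * B j ^ (ρ k + γ l)) =
      (Matrix.of fun k j : Fin (r + 1) => if (j : ℕ) < r then A j * B j ^ ρ k else 0) *
      (Matrix.of fun j l : Fin (r + 1) => B j ^ γ l) := by
    ext k l
    rw [Matrix.mul_apply, Fin.sum_univ_castSucc]
    simp only [Matrix.of_apply, Fin.val_castSucc, Fin.is_lt, if_true, Fin.val_last, lt_irrefl,
      if_false, zero_mul, add_zero]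
    rw [Finset.sum_range]
    exact Finset.sum_congr rfl fun j _ => by rw [pow_add, mul_assoc]
  rw [this, Matrix.det_mul, Matrix.det_eq_zero_of_column_eq_zero (Fin.last r), zero_mul]
  intro i
  simp

lemma HI_le_ker {r a b : ℕ} (hb : b ≤ n) : HI n K (r + 1) a b ≤ RingHom.ker (phi n K r a b) := by
  refine Ideal.span_le.mpr ?_
  rintro d ⟨ρ, γ, h1, h2, h3, rfl⟩
  rw [SetLike.mem_coe, RingHom.mem_ker, mn, AlgHom.map_det]
  rw [← det_low_rank r (fun j => (X (Sum.inl j) : MvPolynomial (ℕ ⊕ ℕ ⊕ ℕ) K))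
    (fun j => X (Sum.inr (Sum.inl j))) ρ γ]
  congr 1
  ext1 k l
  have := h3 k l
  have h4 : ρ k + γ l < n := by omega
  simp only [AlgHom.mapMatrix_apply, Matrix.map_apply, Matrix.of_apply, xv, h4, dif_pos, phi,
    aeval_X, this, and_self, if_true]

/-- exponent `(i-p)(i-p-1)` -/
def ex (i p : ℕ) : ℕ := if i ≤ p then (p - i) * (p - i + 1) else (i - p - 1) * (i - p)

lemma ex_spec (i p : ℕ) : ex i p + i * (2 * p + 1) = i ^ 2 + p * (p + 1) := by
  unfold ex
  split_ifs with h
  · obtain ⟨d, rfl⟩ := exists_add_of_le h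
    rw [add_tsub_cancel_left]; ring
  · obtain ⟨d, rfl⟩ := exists_add_of_le (show p + 1 ≤ i by omega)
    have h1 : p + 1 + d - p - 1 = d := by omega
    have h2 : p + 1 + d - p = d + 1 := by omega
    rw [h1, h2]; ring

lemma ex_eq_zero (i p : ℕ) : ex i p = 0 ↔ i = p ∨ i = p + 1 := by
  unfold ex
  split_ifs with h
  · rw [Nat.mul_eq_zero]; omega
  · rw [Nat.mul_eq_zero]; omega

lemma prod_Z (Q : Fin n → Prop) [DecidablePred Q] (v : Fin n →₀ ℕ) :
    ∏ i, (if Q i then (X i : MvPolynomial (Fin n) K) else 0) ^ v i =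
      if ∀ i, v i ≠ 0 → Q i then monomial v 1 else 0 := by
  split_ifs with h
  · rw [monomial_eq, Finsupp.prod_fintype _ _ (by simp), map_one, one_mul]
    refine Finset.prod_congr rfl fun i _ => ?_
    by_cases hv : v i = 0
    · simp [hv]
    · rw [if_pos (h i hv)]
  · push Not at h
    obtain ⟨i, h1, h2⟩ := h
    exact Finset.prod_eq_zero (Finset.mem_univ i) (by rw [if_neg h2, zero_pow h1])

lemma homog_aux {R S : Type*} [CommRing R] [CommRing S] (κ : K →+* R) (ι : R →+* S) (T : R)
    (x : Fin n → R) (θ : MvPolynomial (Fin n) K →+* S) (hθ : ∀ c, θ (C c) = ι (κ c))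
    (hx : ∀ i, ι (x i) = ι T ^ ((i : ℕ) ^ 2) * θ (X i)) (g : MvPolynomial (Fin n) K) (N : ℕ)
    (hg : g ∈ W K n (N + 1)) :
    ι (∑ u ∈ g.support, κ (coeff u g) * T ^ (N - wt u) * ∏ i, x i ^ u i) = ι T ^ N * θ g := by
  have h1 : θ g = ∑ u ∈ g.support, ι (κ (coeff u g)) * ∏ i, θ (X i) ^ u i := by
    conv_lhs => rw [g.as_sum]
    rw [map_sum]
    refine Finset.sum_congr rfl fun u _ => ?_
    rw [monomial_eq, map_mul, hθ, Finsupp.prod_fintype _ _ (by simp), map_prod]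
    simp only [map_pow]
  rw [h1, map_sum, Finset.mul_sum]
  refine Finset.sum_congr rfl fun u hu => ?_
  have hlt := hg u (mem_support_iff.mp hu)
  rw [map_mul, map_mul, map_prod, map_pow]
  simp only [map_pow, hx, mul_pow, Finset.prod_mul_distrib, ← pow_mul]
  rw [Finset.prod_pow_eq_pow_sum]
  have : ∑ i : Fin n, (i : ℕ) ^ 2 * u i = wt u := by
    rw [wt, Finsupp.weight_eq_sum]
    exact Finset.sum_congr rfl fun i _ => by rw [smul_eq_mul, mul_comm]
  rw [this]
  have h2 : ι T ^ N = ι T ^ (N - wt u) * ι T ^ wt u := by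
    rw [← pow_add]; congr 1; omega
  rw [h2]; ring

lemma upper_ker {r a b : ℕ} : Upper (RingHom.ker (phi n K r a b)) (MM (r + 1) a b) := by
  classical
  intro g hg N hN u hu huN
  by_contra hM
  obtain ⟨p, hp, -, hcov⟩ := cover b _ r a hM
  have hpm : StrictMono p := strictMono_nat_of_lt_succ fun k => by have := hp k; omega
  have hp2 : ∀ k l, k < l → p k + 2 ≤ p l := fun k l h =>
    (hp k).trans (hpm.monotone (show k + 1 ≤ l from h))
  let k' := FractionRing (MvPolynomial (Fin n) K)
  let F := FractionRing (Polynomial k')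
  let em : MvPolynomial (Fin n) K →+* k' := algebraMap _ _
  have em_inj : Function.Injective em := IsFractionRing.injective _ _
  let ι : Polynomial k' →+* F := algebraMap _ _
  have ι_inj : Function.Injective ι := IsFractionRing.injective _ _
  let y : ℕ → k' := fun i => em (if h : i < n then X ⟨i, h⟩ else 1)
  have hy : ∀ i, y i ≠ 0 := by
    intro i
    refine (map_ne_zero_iff em em_inj).mpr ?_
    split_ifs
    · exact X_ne_zero _
    · exact one_ne_zero
  let β : ℕ → k' := fun k => y (p k + 1) / y (p k)
  have hβ : ∀ k, β k ≠ 0 := fun k => div_ne_zero (hy _) (hy _)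
  let α : ℕ → k' := fun k => y (p k) / β k ^ p k
  have hα0 : ∀ k, α k * β k ^ p k = y (p k) := fun k =>
    div_mul_cancel₀ _ (pow_ne_zero _ (hβ k))
  have hα1 : ∀ k, α k * β k ^ (p k + 1) = y (p k + 1) := fun k => by
    rw [pow_succ, ← mul_assoc, hα0]; exact mul_div_cancel₀ _ (hy _)
  let τ : F := ι Polynomial.X
  have hτ : τ ≠ 0 := (map_ne_zero_iff ι ι_inj).mpr Polynomial.X_ne_zero
  let κ : K →+* Polynomial k' := Polynomial.C.comp (em.comp C)
  let ψ : MvPolynomial (ℕ ⊕ ℕ ⊕ ℕ) K →+* F := eval₂Hom (ι.comp κ)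
    (Sum.elim (fun k => ι (Polynomial.C (α k)) * τ ^ (p k * (p k + 1)))
      (Sum.elim (fun k => ι (Polynomial.C (β k)) * (τ ^ (2 * p k + 1))⁻¹)
        (fun i => ι (Polynomial.C (y i)) * (τ ^ (i ^ 2))⁻¹)))
  let θ : MvPolynomial (Fin n) K →+* F := ψ.comp (phi n K r a b).toRingHom
  let x : Fin n → Polynomial k' := fun i => if a ≤ (i : ℕ) ∧ (i : ℕ) < b then
    ∑ k ∈ Finset.range r, Polynomial.C (α k * β k ^ (i : ℕ)) * Polynomial.X ^ (ex i (p k))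
    else Polynomial.C (y i)
  have hθ : ∀ c, θ (C c) = ι (κ c) := by
    intro c
    simp [θ, ψ]
  have hx : ∀ i, ι (x i) = ι Polynomial.X ^ ((i : ℕ) ^ 2) * θ (X i) := by
    intro i
    change ι (x i) = τ ^ ((i : ℕ) ^ 2) * ψ (phi n K r a b (X i))
    rw [phi, aeval_X]
    simp only [x]
    split_ifs with h
    · rw [map_sum, map_sum, Finset.mul_sum]
      refine Finset.sum_congr rfl fun k _ => ?_
      simp only [ψ, map_mul, map_pow, coe_eval₂Hom, eval₂_X, Sum.elim_inl,
        Sum.elim_inr]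
      have := ex_spec i (p k)
      have h2 : τ ^ ((i : ℕ) ^ 2) * τ ^ (p k * (p k + 1)) =
          τ ^ ex i (p k) * (τ ^ (2 * p k + 1)) ^ (i : ℕ) := by
        rw [← pow_mul, ← pow_add, ← pow_add, ← this, mul_comm (i : ℕ)]
      have h3 : (τ ^ (2 * p k + 1)) ^ (i : ℕ) ≠ 0 := pow_ne_zero _ (pow_ne_zero _ hτ)
      change _ * τ ^ ex i (p k) = _
      rw [mul_pow, inv_pow]
      calc _ = ι (Polynomial.C (α k)) * ι (Polynomial.C (β k)) ^ (i : ℕ) *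
            (τ ^ ex i (p k) * (τ ^ (2 * p k + 1)) ^ (i : ℕ)) *
            ((τ ^ (2 * p k + 1)) ^ (i : ℕ))⁻¹ := by
              rw [mul_assoc _ (_ * _) (_)⁻¹, mul_assoc (τ ^ ex i (p k)), mul_inv_cancel₀ h3,
                mul_one]
        _ = _ := by rw [← h2]; ring
    · simp only [ψ, coe_eval₂Hom, eval₂_X, Sum.elim_inr]
      rw [mul_left_comm, mul_inv_cancel₀ (pow_ne_zero _ hτ), mul_one]
  have hzero := homog_aux κ ι Polynomial.X x θ hθ hx g N hN
  have hθg : θ g = 0 := by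
    change ψ (phi n K r a b g) = 0
    rw [RingHom.mem_ker.mp hg, map_zero]
  rw [hθg, mul_zero, map_eq_zero_iff ι ι_inj] at hzero
  have hev := congrArg (Polynomial.eval 0) hzero
  let Q : Fin n → Prop := fun i => ¬ (a ≤ (i : ℕ) ∧ (i : ℕ) < b) ∨
    ∃ k, k < r ∧ ((i : ℕ) = p k ∨ (i : ℕ) = p k + 1)
  have hyX : ∀ i : Fin n, y i = em (X i) := by
    intro i
    simp [y]
  have hx0 : ∀ i, (x i).eval 0 = em (if Q i then X i else 0) := by
    intro i
    simp only [x]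
    split_ifs with h hQ hQ
    · rcases hQ with hQ | ⟨k, hk, hik⟩
      · exact absurd h hQ
      · rw [Polynomial.eval_finsetSum, Finset.sum_eq_single k]
        · rw [(ex_eq_zero i (p k)).mpr hik]
          simp only [pow_zero, mul_one, Polynomial.eval_C]
          rw [← hyX]
          rcases hik with h | h
          · rw [h, hα0]
          · rw [h, hα1]
        · intro l _ hl
          have : ex i (p l) ≠ 0 := by
            rw [Ne, ex_eq_zero]
            rcases lt_or_gt_of_ne hl with h | h
            · have := hp2 _ _ h; omega
            · have := hp2 _ _ h; omega
          simp [this]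
        · intro h; exact absurd (Finset.mem_range.mpr hk) h
    · rw [Polynomial.eval_finsetSum, map_zero]
      refine Finset.sum_eq_zero fun l hl => ?_
      have : ex i (p l) ≠ 0 := by
        rw [Ne, ex_eq_zero]
        intro h
        exact hQ (Or.inr ⟨l, Finset.mem_range.mp hl, h⟩)
      simp [this]
    · rw [Polynomial.eval_C, hyX]
    · exact absurd (Or.inl h) hQ
  rw [Polynomial.eval_finsetSum, Polynomial.eval_zero] at hev
  have hev2 : em (∑ v ∈ g.support, C (coeff v g) * 0 ^ (N - wt v) *
      ∏ i, (if Q i then X i else 0) ^ v i) = 0 := by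
    rw [← hev, map_sum]
    refine Finset.sum_congr rfl fun v _ => ?_
    simp only [Polynomial.eval_mul, Polynomial.eval_pow, Polynomial.eval_X, Polynomial.eval_prod,
      hx0, map_mul, map_pow, map_prod, map_zero, κ, RingHom.comp_apply, Polynomial.eval_C]
  rw [map_eq_zero_iff em em_inj] at hev2
  have hco := congrArg (coeff u) hev2
  rw [coeff_sum, coeff_zero, Finset.sum_eq_single u] at hco
  · rw [huN, Nat.sub_self, pow_zero, mul_one, coeff_C_mul, prod_Z, if_pos] at hco
    · rw [coeff_monomial, if_pos rfl, mul_one] at hco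
      exact hu hco
    · intro i hi
      by_cases h : a ≤ (i : ℕ) ∧ (i : ℕ) < b
      · exact Or.inr (hcov i h.1 h.2 ⟨i.2, hi⟩)
      · exact Or.inl h
  · intro v _ hv
    rw [prod_Z, mul_assoc, coeff_C_mul]
    split_ifs
    · rcases Nat.eq_zero_or_pos (N - wt v) with h | h
      · rw [h, pow_zero, one_mul, coeff_monomial, if_neg hv, mul_zero]
      · rw [zero_pow h.ne', zero_mul, coeff_zero, mul_zero]
    · simp
  · intro h
    exact absurd (mem_support_iff.mpr hu) h

lemma HI_eq_ker {r a b : ℕ} (hb : b ≤ n) : HI n K (r + 1) a b = RingHom.ker (phi n K r a b) :=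
  eq_of_le (HI_le_ker hb) (lower_HI hb) upper_ker

lemma upper_HI {t a b : ℕ} (hb : b ≤ n) : Upper (HI n K t a b) (MM t a b) := by
  rcases t with _ | r
  · intro g _ N _ u _ _
    exact ⟨fun _ => 0, fun k hk => absurd hk (by omega), fun k hk => absurd hk (by omega)⟩
  · rw [HI_eq_ker hb]; exact upper_ker

lemma prime_HI {r a b : ℕ} (hb : b ≤ n) : (HI n K (r + 1) a b).IsPrime := by
  rw [HI_eq_ker hb]; exact RingHom.ker_isPrime _

end Param

section Final

variable {n : ℕ} {K : Type*} [Field K]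

lemma not_le_HI {t a b t' a' b' : ℕ} (hb : b ≤ n) (hb' : b' ≤ n) (T : Set ℕ) (h : Ch t a b T)
    (h' : ¬ Ch t' a' b' T) : ¬ HI n K t a b ≤ HI n K t' a' b' := by
  classical
  let u : Fin n →₀ ℕ := Finsupp.equivFunOnFinite.symm (fun i => if (i : ℕ) ∈ T then 1 else 0)
  refine not_le (lower_HI hb) (upper_HI hb') u ?_ ?_
  · obtain ⟨c, h1, h2⟩ := h
    refine ⟨c, h1, fun k hk => ?_⟩
    obtain ⟨h3, h4, h5⟩ := h2 k hk
    exact ⟨h3, h4, by omega, by simp [u, h5]⟩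
  · intro h
    apply h'
    refine h.mono le_rfl le_rfl ?_
    rintro i ⟨hi, hi'⟩
    by_contra hT
    exact hi' (by simp [u, hT])

lemma knutson_of_inf {f : MvPolynomial (Fin n) K} {P Q : Ideal (MvPolynomial (Fin n) K)}
    (h : KnutsonFamily f (P ⊓ Q)) (hP : P.IsPrime) (hQ : ¬ Q ≤ P) : KnutsonFamily f P := by
  have : (P ⊓ Q).colon (Q : Set (MvPolynomial (Fin n) K)) = P := by
    refine le_antisymm ?_ ?_
    · intro x hx
      obtain ⟨q, hq, hqP⟩ := SetLike.not_le_iff_exists.mp hQ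
      exact (hP.mem_or_mem (Submodule.mem_colon.mp hx q hq).1).resolve_right hqP
    · intro x hx
      rw [Submodule.mem_colon]
      intro q hq
      exact ⟨P.mul_mem_right q hx, Q.mul_mem_left x hq⟩
  rw [← this]
  exact KnutsonFamily.colon _ Q h

lemma eq1 {s : ℕ} (hs : 2 * (s + 1) ≤ n) :
    HI n K (s + 1) 1 n + HI n K (s + 1) 0 (n - 1) = HI n K (s + 1) 0 n ⊓ HI n K s 1 (n - 1) := by
  refine eq_of_le (M := fun u => MM (s + 1) 0 n u ∧ MM s 1 (n - 1) u) ?_ ?_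
    ((upper_HI le_rfl).inf (upper_HI (by omega)))
  · refine sup_le (le_inf (HI_mono (by omega) le_rfl) HI_succ_right)
      (le_inf (HI_mono le_rfl (by omega)) HI_succ_left)
  · intro u ⟨h1, h2⟩
    rcases comb1 hs h1 h2 with h | h
    · exact ((lower_HI le_rfl).mono le_sup_left fun _ h => h) u h
    · exact ((lower_HI (by omega)).mono le_sup_right fun _ h => h) u h

lemma eq2 {s : ℕ} (hs : 1 ≤ s) (hn : n ≠ 2 * s) :
    HI n K (s + 1) 0 n + HI n K s 1 (n - 1) = HI n K s 1 n ⊓ HI n K s 0 (n - 1) := by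
  refine eq_of_le (M := fun u => MM s 1 n u ∧ MM s 0 (n - 1) u) ?_ ?_
    ((upper_HI le_rfl).inf (upper_HI (by omega)))
  · refine sup_le (le_inf HI_succ_left HI_succ_right)
      (le_inf (HI_mono le_rfl (by omega)) (HI_mono (by omega) le_rfl))
  · intro u ⟨h1, h2⟩
    rcases comb2 hs hn h1 h2 with h | h
    · exact ((lower_HI le_rfl).mono le_sup_left fun _ h => h) u h
    · exact ((lower_HI (by omega)).mono le_sup_right fun _ h => h) u h

lemma knutson_A {f : MvPolynomial (Fin n) K} {s : ℕ} (hs : 2 * (s + 1) ≤ n)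
    (hB : KnutsonFamily f (HI n K (s + 1) 1 n)) (hC : KnutsonFamily f (HI n K (s + 1) 0 (n - 1))) :
    KnutsonFamily f (HI n K (s + 1) 0 n) := by
  have h := KnutsonFamily.add _ _ hB hC
  rw [eq1 hs] at h
  refine knutson_of_inf h (prime_HI le_rfl) (not_le_HI (by omega) le_rfl
    {i | ∃ k, k < s ∧ i = 2 * k + 1} ?_ ?_)
  · exact ⟨fun k => 2 * k + 1, fun k _ => by simp only; omega,
      fun k hk => ⟨by show 1 ≤ 2 * k + 1; omega, by show 2 * k + 1 < n - 1; omega, k, hk, rfl⟩⟩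
  · rintro ⟨c, hc, hc'⟩
    have h1 := chain_lt hc 0 s (by omega) (by omega)
    obtain ⟨_, _, k, hk, hk'⟩ := hc' s (by omega)
    obtain ⟨_, _, l, hl, hl'⟩ := hc' 0 (by omega)
    omega

lemma knutson_D {f : MvPolynomial (Fin n) K} {r : ℕ} (hs : 2 * (r + 2) ≤ n)
    (hB : KnutsonFamily f (HI n K (r + 2) 1 n)) (hC : KnutsonFamily f (HI n K (r + 2) 0 (n - 1))) :
    KnutsonFamily f (HI n K (r + 1) 1 (n - 1)) := by
  have h := KnutsonFamily.add _ _ hB hC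
  rw [eq1 (by omega), inf_comm] at h
  refine knutson_of_inf h (prime_HI (by omega)) (not_le_HI (by omega) (by omega)
    {i | (∃ k, k ≤ r ∧ i = 2 * k) ∨ i = n - 1} ?_ ?_)
  · refine ⟨fun k => if k ≤ r then 2 * k else n - 1, fun k hk => ?_, fun k hk => ?_⟩
    · have : k ≤ r := by omega
      simp only [this, if_true]; split_ifs <;> omega
    · by_cases h : k ≤ r
      · simp only [h, if_true]; exact ⟨by omega, by omega, Or.inl ⟨k, h, rfl⟩⟩
      · simp only [h, if_false]; exact ⟨by omega, by omega, Or.inr rfl⟩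
  · rintro ⟨c, hc, hc'⟩
    have h1 := chain_lt hc 0 r (by omega) (by omega)
    obtain ⟨a1, a2, h2⟩ := hc' r (by omega)
    obtain ⟨a3, a4, h3⟩ := hc' 0 (by omega)
    rcases h2 with ⟨k, hk, hk'⟩ | h2 <;> rcases h3 with ⟨l, hl, hl'⟩ | h3 <;> omega

lemma knutson_BC {f : MvPolynomial (Fin n) K} {r : ℕ} (hs : 2 * (r + 2) ≤ n)
    (hB : KnutsonFamily f (HI n K (r + 2) 1 n)) (hC : KnutsonFamily f (HI n K (r + 2) 0 (n - 1))) :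
    KnutsonFamily f (HI n K (r + 1) 1 n) ∧ KnutsonFamily f (HI n K (r + 1) 0 (n - 1)) := by
  have h := KnutsonFamily.add _ _ (knutson_A (by omega) hB hC) (knutson_D hs hB hC)
  rw [eq2 (by omega) (by omega)] at h
  constructor
  · refine knutson_of_inf h (prime_HI le_rfl) (not_le_HI (by omega) (by omega)
      {i | ∃ k, k ≤ r ∧ i = 2 * k} ?_ ?_)
    · exact ⟨fun k => 2 * k, fun k _ => by simp only; omega,
        fun k hk => ⟨by show 0 ≤ 2 * k; omega, by show 2 * k < n - 1; omega, k, by omega, rfl⟩⟩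
    · rintro ⟨c, hc, hc'⟩
      have h1 := chain_lt hc 0 r (by omega) (by omega)
      obtain ⟨a1, a2, k, hk, hk'⟩ := hc' r (by omega)
      obtain ⟨a3, a4, l, hl, hl'⟩ := hc' 0 (by omega)
      omega
  · rw [inf_comm] at h
    refine knutson_of_inf h (prime_HI (by omega)) (not_le_HI (by omega) (by omega)
      {i | (∃ k, k < r ∧ i = 2 * k + 1) ∨ i = n - 1} ?_ ?_)
    · refine ⟨fun k => if k < r then 2 * k + 1 else n - 1, fun k hk => ?_, fun k hk => ?_⟩
      · have : k < r := by omega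
        simp only [this, if_true]; split_ifs <;> omega
      · by_cases h : k < r
        · simp only [h, if_true]; exact ⟨by omega, by omega, Or.inl ⟨k, h, rfl⟩⟩
        · simp only [h, if_false]; exact ⟨by omega, by omega, Or.inr rfl⟩
    · rintro ⟨c, hc, hc'⟩
      have h1 := chain_lt hc 0 r (by omega) (by omega)
      obtain ⟨a1, a2, h2⟩ := hc' r (by omega)
      obtain ⟨a3, a4, h3⟩ := hc' 0 (by omega)
      rcases h2 with ⟨k, hk, hk'⟩ | h2 <;> rcases h3 with ⟨l, hl, hl'⟩ | h3 <;> omega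

end Final

section Main

variable {K : Type*} [Field K] {m : ℕ}

lemma mn_hankelX {t : ℕ} (ρ : Fin t → Fin m) (γ : Fin t → Fin (m + 1)) :
    ((hankelX' K m).submatrix ρ γ).det =
      mn (2 * m) K (fun k => (ρ k : ℕ)) (fun k => (γ k : ℕ)) := by
  rw [mn]
  congr 1
  ext1 k l
  have h : (ρ k : ℕ) + γ l < 2 * m := by omega
  simp only [Matrix.submatrix_apply, hankelX', Matrix.of_apply, xv, h, dif_pos]

lemma minors_eq (t : ℕ) : minorsIdeal t (hankelX' K m) = HI (2 * m) K t 0 (2 * m) := by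
  refine eq_of_le (M := MM t 0 (2 * m)) ?_ ?_ (upper_HI le_rfl)
  · refine Ideal.span_le.mpr ?_
    rintro d ⟨ρ, γ, h1, h2, rfl⟩
    refine Ideal.subset_span ⟨_, _, fun i j h => h1 h, fun i j h => h2 h, fun k l => ?_,
      mn_hankelX ρ γ⟩
    have := (ρ k).2
    have := (γ l).2
    omega
  · refine lower_of le_rfl _ fun c hc hc' => Ideal.subset_span ?_
    have hlt := chain_lt hc
    refine ⟨fun k => ⟨c k / 2, by have := hc' k k.2; omega⟩,
      fun k => ⟨(c k + 1) / 2, by have := hc' k k.2; omega⟩, ?_, ?_, ?_⟩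
    · intro i j hij
      have := hlt i j hij.le j.2
      have : (i : ℕ) < j := hij
      simp only [Fin.mk_lt_mk]; omega
    · intro i j hij
      have := hlt i j hij.le j.2
      have : (i : ℕ) < j := hij
      simp only [Fin.mk_lt_mk]; omega
    · rw [mn_hankelX]

lemma P1_eq : (hankelP1' K m).det = mn (2 * m) K (fun k : Fin m => (k : ℕ)) (fun k => (k : ℕ)) := by
  rw [mn]
  congr 1
  ext1 k l
  have h : (k : ℕ) + l < 2 * m := by omega
  simp only [hankelP1', Matrix.of_apply, xv, h, dif_pos]

lemma P2_eq : (hankelP2' K m).det =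
    mn (2 * m) K (fun k : Fin m => (k : ℕ)) (fun k => (k : ℕ) + 1) := by
  rw [mn]
  congr 1
  ext1 k l
  have h : (k : ℕ) + (l + 1) < 2 * m := by omega
  simp only [hankelP2', Matrix.of_apply, xv, h, dif_pos, add_assoc]

lemma span_P1 : Ideal.span {(hankelP1' K m).det} = HI (2 * m) K m 0 (2 * m - 1) := by
  rw [P1_eq]
  refine eq_of_le (M := MM m 0 (2 * m - 1)) ?_ ?_ (upper_HI (by omega))
  · refine Ideal.span_mono (Set.singleton_subset_iff.mpr ?_)
    exact ⟨_, _, fun i j h => h, fun i j h => h, fun k l => by omega, rfl⟩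
  · refine lower_of (by omega) _ fun c hc hc' => Ideal.subset_span ?_
    have hlt := chain_lt hc
    have : ∀ k : Fin m, c k = 2 * k := by
      intro k
      have := k.2
      have := hlt 0 k (by omega) (by omega)
      have := hlt k (m - 1) (by omega) (by omega)
      have := hc' (m - 1) (by omega)
      omega
    rw [Set.mem_singleton_iff]
    congr 1 <;> (funext k; rw [this]; omega)

lemma span_P2 : Ideal.span {(hankelP2' K m).det} = HI (2 * m) K m 1 (2 * m) := by
  rw [P2_eq]
  refine eq_of_le (M := MM m 1 (2 * m)) ?_ ?_ (upper_HI (by omega))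
  · refine Ideal.span_mono (Set.singleton_subset_iff.mpr ?_)
    exact ⟨_, _, fun i j h => h, fun i j h => Nat.succ_lt_succ h, fun k l => by omega,
      rfl⟩
  · refine lower_of (by omega) _ fun c hc hc' => Ideal.subset_span ?_
    have hlt := chain_lt hc
    have : ∀ k : Fin m, c k = 2 * k + 1 := by
      intro k
      have := k.2
      have := hlt 0 k (by omega) (by omega)
      have := hlt k (m - 1) (by omega) (by omega)
      have := hc' (m - 1) (by omega)
      have := hc' 0 (by omega)
      omega
    rw [Set.mem_singleton_iff]
    congr 1 <;> (funext k; rw [this]; omega)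

lemma colon_principal {n : ℕ} (p q : MvPolynomial (Fin n) K) (hp : p ≠ 0) :
    KnutsonFamily (p * q) (Ideal.span {q}) := by
  have : (Ideal.span {p * q}).colon ((Ideal.span {p} : Ideal (MvPolynomial (Fin n) K)) :
      Set (MvPolynomial (Fin n) K)) = Ideal.span {q} := by
    ext x
    rw [Submodule.mem_colon, Ideal.mem_span_singleton]
    constructor
    · intro h
      have := h p (Ideal.mem_span_singleton_self p)
      rw [smul_eq_mul, Ideal.mem_span_singleton, mul_comm x p] at this
      exact (mul_dvd_mul_iff_left hp).mp this
    · intro h s hs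
      rw [SetLike.mem_coe, Ideal.mem_span_singleton] at hs
      rw [smul_eq_mul, Ideal.mem_span_singleton, mul_comm x s]
      exact mul_dvd_mul hs h
  rw [← this]
  exact KnutsonFamily.colon _ _ KnutsonFamily.base

lemma lead_aux {n t : ℕ} (ord : MonomialOrder (Fin n)) (g : MvPolynomial (Fin n) K)
    (c : Fin t → Fin n) (h : ord.leadTerm g = ∏ k, X (c k)) :
    g ≠ 0 ∧ ord.degree g = ∑ k, Finsupp.single (c k) 1 := by
  have h1 : (∏ k, X (c k) : MvPolynomial (Fin n) K) = monomial (∑ k, Finsupp.single (c k) 1) 1 := by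
    rw [monomial_sum_one]; rfl
  rw [h1, MonomialOrder.leadTerm] at h
  have h2 := (MvPolynomial.monomial_eq_monomial_iff _ _ _ _).mp h
  rcases h2 with h2 | h2
  · refine ⟨?_, h2.1⟩
    rintro rfl
    exact zero_ne_one h2.2
  · exact absurd h2.2 one_ne_zero

end Main

end HK

/-- **Theorem 3.3.** Let `n = 2m`, `X` the generic `m × (m+1)` Hankel matrix, `P₁` (resp. `P₂`)
the square Hankel matrices obtained by dropping the last (resp. first) column of `X`, and
`f = det P₁ · det P₂`. With respect to a diagonal term order (one for which the leading term of
every minor of `X` is the product of its diagonal entries), `lt(f)` is a squarefree monomial,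
and `I_t(X) ∈ C_f` for every `t = 1, …, m`. -/
theorem hankel_minors_knutson_rect {K : Type*} [Field K] (m : ℕ) (hm : 1 ≤ m)
    (ord : MonomialOrder (Fin (2 * m)))
    (hdiag : ∀ (t : ℕ) (ρ : Fin t → Fin m) (γ : Fin t → Fin (m + 1)),
      StrictMono ρ → StrictMono γ →
      ord.leadTerm ((hankelX' K m).submatrix ρ γ).det = ∏ k, (hankelX' K m) (ρ k) (γ k)) :
    ord.HasSqfreeLeadTerm ((hankelP1' K m).det * (hankelP2' K m).det) ∧
      ∀ t : ℕ, 1 ≤ t → t ≤ m →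
        KnutsonFamily ((hankelP1' K m).det * (hankelP2' K m).det)
          (minorsIdeal t (hankelX' K m)) := by
  classical
  have hX1 : ((hankelX' K m).submatrix id Fin.castSucc) = hankelP1' K m := rfl
  have hX2 : ((hankelX' K m).submatrix id Fin.succ) = hankelP2' K m := rfl
  have h1 := hdiag m id Fin.castSucc strictMono_id Fin.strictMono_castSucc
  have h2 := hdiag m id Fin.succ strictMono_id Fin.strictMono_succ
  rw [hX1] at h1
  rw [hX2] at h2
  obtain ⟨hne1, hd1⟩ := HK.lead_aux ord _ (fun k : Fin m => ⟨k + k, by omega⟩) h1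
  obtain ⟨hne2, hd2⟩ := HK.lead_aux ord _ (fun k : Fin m => ⟨k + (k + 1), by omega⟩) h2
  refine ⟨⟨mul_ne_zero hne1 hne2, ?_⟩, ?_⟩
  · intro i
    change ord.degree _ i ≤ 1
    rw [ord.degree_mul hne1 hne2, hd1, hd2, Finsupp.add_apply, Finsupp.finsetSum_apply,
      Finsupp.finsetSum_apply]
    simp only [Finsupp.single_apply]
    rcases Nat.even_or_odd' (i : ℕ) with ⟨k, hk | hk⟩
    · have e2 : ∑ x : Fin m, (if (⟨x + (x + 1), by omega⟩ : Fin (2 * m)) = i then 1 else 0) = 0 :=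
        Finset.sum_eq_zero fun x _ => if_neg (by rw [Fin.ext_iff]; simp only; omega)
      have e1 : ∑ x : Fin m, (if (⟨x + x, by omega⟩ : Fin (2 * m)) = i then 1 else 0) = 1 := by
        rw [Finset.sum_eq_single (⟨k, by omega⟩ : Fin m)]
        · exact if_pos (by rw [Fin.ext_iff]; simp only; omega)
        · intro x _ hx
          rw [Ne, Fin.ext_iff] at hx
          exact if_neg (by rw [Fin.ext_iff]; simp only at *; omega)
        · simp
      exact (congrArg₂ (· + ·) e1 e2).le
    · have e1 : ∑ x : Fin m, (if (⟨x + x, by omega⟩ : Fin (2 * m)) = i then 1 else 0) = 0 :=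
        Finset.sum_eq_zero fun x _ => if_neg (by rw [Fin.ext_iff]; simp only; omega)
      have e2 : ∑ x : Fin m, (if (⟨x + (x + 1), by omega⟩ : Fin (2 * m)) = i then 1 else 0) = 1 := by
        rw [Finset.sum_eq_single (⟨k, by omega⟩ : Fin m)]
        · exact if_pos (by rw [Fin.ext_iff]; simp only; omega)
        · intro x _ hx
          rw [Ne, Fin.ext_iff] at hx
          exact if_neg (by rw [Fin.ext_iff]; simp only at *; omega)
        · simp
      exact (congrArg₂ (· + ·) e1 e2).le
  · have hB : KnutsonFamily ((hankelP1' K m).det * (hankelP2' K m).det)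
        (HK.HI (2 * m) K m 1 (2 * m)) := by
      rw [← HK.span_P2]; exact HK.colon_principal _ _ hne1
    have hC : KnutsonFamily ((hankelP1' K m).det * (hankelP2' K m).det)
        (HK.HI (2 * m) K m 0 (2 * m - 1)) := by
      rw [← HK.span_P1, mul_comm (hankelP1' K m).det]; exact HK.colon_principal _ _ hne2
    have key : ∀ d t, t + 1 + d = m →
        KnutsonFamily ((hankelP1' K m).det * (hankelP2' K m).det)
          (HK.HI (2 * m) K (t + 1) 1 (2 * m)) ∧
        KnutsonFamily ((hankelP1' K m).det * (hankelP2' K m).det)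
          (HK.HI (2 * m) K (t + 1) 0 (2 * m - 1)) := by
      intro d
      induction d with
      | zero => intro t ht; rw [show t + 1 = m by omega]; exact ⟨hB, hC⟩
      | succ d ih =>
        intro t ht
        obtain ⟨h3, h4⟩ := ih (t + 1) (by omega)
        exact HK.knutson_BC (by omega) h3 h4
    intro t ht1 htm
    obtain ⟨s, rfl⟩ : ∃ s, t = s + 1 := ⟨t - 1, by omega⟩
    rw [HK.minors_eq]
    obtain ⟨h3, h4⟩ := key (m - (s + 1)) s (by omega)
    exact HK.knutson_A (by omega) h3 h4
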